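/- Let T̲ : ℝ^𝒳 → ℝ^𝒳 be a coherent map satisfying the reachability condition (R1), and let T be any element of its dual representation 𝒯 (i.e., T is linear, coherent, and T̲f ≤ Tf for all f ∈ ℝ^𝒳). Then the powers of the restriction satisfy lim_{k→∞}(T|_{Aᶜ})ᵏ = 0 in operator norm; moreover, I − T|_{Aᶜ} is invertible and (I − T|_{Aᶜ})^{−1} = Σ_{k=0}^{∞}(T|_{Aᶜ})ᵏ, where I is the identity map on ℝ^{Aᶜ} and the series converges in operator norm. -/

import Mathlib

open Function Set Filter Topology

/-- A map `T : ℝ^𝒳 → ℝ^𝒳` is *coherent* if it is non-negatively homogeneous (C1),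
super-additive (C2), and dominates the pointwise minimum (C3). -/
def Coherent {X : Type*} [Fintype X] [Nonempty X] (T : (X → ℝ) → (X → ℝ)) : Prop :=
  (∀ (α : ℝ), 0 ≤ α → ∀ f, T (α • f) = α • T f) ∧
  (∀ f g, T f + T g ≤ T (f + g)) ∧
  (∀ (f : X → ℝ) (x : X), (⨅ y, f y) ≤ T f x)

/-- The reachability condition (R1) with respect to the target set `A`. -/
def Reach {X : Type*} (A : Set X) (T : (X → ℝ) → (X → ℝ)) : Prop :=
  ∀ x ∈ Aᶜ, ∃ n : ℕ, 0 < n ∧ 0 < T^[n] (A.indicator 1) x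

/-- The restriction `M|_{Aᶜ}` of a map `M : ℝ^𝒳 → ℝ^𝒳` to `ℝ^{Aᶜ}`: the argument `f` is
extended by zero to `𝒳` (this extension is `g·𝟙_{Aᶜ}` for any `g` with `g|_{Aᶜ} = f`),
`M` is applied, and the result is restricted to `Aᶜ`. -/
noncomputable def restr {X : Type*} (A : Set X) (M : (X → ℝ) → (X → ℝ)) :
    (↥(Aᶜ) → ℝ) → (↥(Aᶜ) → ℝ) :=
  fun f x => M (Function.extend (Subtype.val : ↥(Aᶜ) → X) f 0) x.val

theorem Coherent.monotone {X : Type*} [Fintype X] [Nonempty X] {T : (X → ℝ) → (X → ℝ)}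
    (hT : Coherent T) : Monotone T := by
  intro f g hfg x
  have h1 := hT.2.1 f (g - f) x
  have h2 := hT.2.2 (g - f) x
  have h3 : (0 : ℝ) ≤ ⨅ y, (g - f) y := le_ciInf fun y => sub_nonneg.2 (hfg y)
  rw [add_sub_cancel] at h1
  simp only [Pi.add_apply] at h1
  linarith

theorem Coherent.map_one {X : Type*} [Fintype X] [Nonempty X] {T : (X → ℝ) → (X → ℝ)}
    (hT : Coherent T) (hlin : IsLinearMap ℝ T) : T 1 = 1 := by
  funext x
  have h1 := hT.2.2 1 x
  have h2 := hT.2.2 (-1) x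
  rw [hlin.map_neg] at h2
  simp only [Pi.one_apply, Pi.neg_apply, ciInf_const] at h1 h2 ⊢
  linarith

/-- If some power of `a` is a strict contraction, the geometric series of `a` converges. -/
theorem summable_pow_of_norm_pow_lt_one {R : Type*} [NormedRing R] [CompleteSpace R] {a : R}
    {N : ℕ} (h : ‖a ^ N‖ < 1) : Summable fun k : ℕ => a ^ k := by
  refine Summable.of_norm (summable_of_sum_range_le
    (c := (∑ i ∈ Finset.range N, ‖a ^ i‖) / (1 - ‖a ^ N‖)) (fun _ => norm_nonneg _) fun n => ?_)
  rw [le_div_iff₀ (sub_pos.2 h)]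
  have h1 : ∑ i ∈ Finset.range n, ‖a ^ i‖ ≤ ∑ i ∈ Finset.range (N + n), ‖a ^ i‖ :=
    Finset.sum_le_sum_of_subset_of_nonneg (Finset.range_mono (Nat.le_add_left n N))
      fun _ _ _ => norm_nonneg _
  have h2 : ∑ i ∈ Finset.range n, ‖a ^ (N + i)‖ ≤ ‖a ^ N‖ * ∑ i ∈ Finset.range n, ‖a ^ i‖ := by
    rw [Finset.mul_sum]
    exact Finset.sum_le_sum fun i _ => pow_add a N i ▸ norm_mul_le _ _
  rw [Finset.sum_range_add] at h1
  linarith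

/-- A monotone linear operator on `ℝ^ι` has norm at most `c` as soon as it maps `1` below `c`. -/
theorem norm_le_of_monotone_of_map_one_le {ι : Type*} [Fintype ι]
    {M : (ι → ℝ) →L[ℝ] (ι → ℝ)} (hmono : Monotone M) {c : ℝ} (hc : 0 ≤ c)
    (h : ∀ x, M 1 x ≤ c) : ‖M‖ ≤ c := by
  refine M.opNorm_le_bound hc fun f => (pi_norm_le_iff_of_nonneg (by positivity)).2 fun x => ?_
  have key : ∀ g : ι → ℝ, ‖g‖ = ‖f‖ → M g x ≤ c * ‖f‖ := by
    intro g hg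
    have h1 : g ≤ ‖f‖ • (1 : ι → ℝ) := fun y => by
      simpa [hg] using (Real.le_norm_self (g y)).trans (norm_le_pi_norm g y)
    have h2 := hmono h1 x
    rw [map_smul, Pi.smul_apply, smul_eq_mul, mul_comm] at h2
    exact h2.trans (mul_le_mul_of_nonneg_right (h x) (norm_nonneg f))
  have h1 := key f rfl
  have h2 := key (-f) (norm_neg f)
  rw [map_neg, Pi.neg_apply] at h2
  exact abs_le.2 ⟨by linarith, h1⟩

theorem coe_pow_eq_iterate {E : Type*} [NormedAddCommGroup E] [NormedSpace ℝ E]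
    (M : E →L[ℝ] E) (n : ℕ) : ⇑(M ^ n) = M^[n] :=
  hom_coe_pow (fun f : E →L[ℝ] E => ⇑f) rfl (fun _ _ => rfl) M n

theorem summable_pow_of_monotone {ι : Type*} [Fintype ι]
    {M : (ι → ℝ) →L[ℝ] (ι → ℝ)} (hmono : Monotone M) (hone : M 1 ≤ 1)
    (h : ∀ x, ∃ n : ℕ, (M ^ n) 1 x < 1) : Summable fun k : ℕ => M ^ k := by
  have hmono_pow : ∀ k : ℕ, Monotone (M ^ k) := fun k => by
    rw [coe_pow_eq_iterate]
    exact hmono.iterate k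
  have hanti : Antitone fun k : ℕ => (M ^ k) 1 := antitone_nat_of_succ_le fun k => by
    rw [pow_succ]
    exact hmono_pow k hone
  choose n hn using h
  set N := Finset.univ.sup n
  have hN : ∀ x, (M ^ N) 1 x < 1 := fun x =>
    (hanti (Finset.le_sup (Finset.mem_univ x)) x).trans_lt (hn x)
  refine summable_pow_of_norm_pow_lt_one (N := N) ?_
  have h0 : ∀ x, 0 ≤ (M ^ N) 1 x := fun x => by
    have := hmono_pow N (zero_le_one (α := ι → ℝ)) x
    rwa [map_zero] at this
  have hlt : ‖(M ^ N) 1‖ < 1 := (pi_norm_lt_iff one_pos).2 fun x => by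
    rw [Real.norm_of_nonneg (h0 x)]
    exact hN x
  exact (norm_le_of_monotone_of_map_one_le (hmono_pow N) (norm_nonneg _) fun x =>
    (Real.le_norm_self _).trans (norm_le_pi_norm _ x)).trans_lt hlt

theorem extend_val_le {X : Type*} {A : Set X} {f : ↥(Aᶜ) → ℝ} {g : X → ℝ}
    (h : ∀ x : ↥(Aᶜ), f x ≤ g x) (hA : ∀ x ∈ A, 0 ≤ g x) :
    Function.extend (Subtype.val : ↥(Aᶜ) → X) f 0 ≤ g := by
  intro x
  by_cases hx : x ∈ A
  · rw [Function.extend_apply' _ _ _ (by rintro ⟨y, rfl⟩; exact y.2 hx)]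
    exact hA x hx
  · exact (Subtype.val_injective.extend_apply f 0 (⟨x, hx⟩ : ↥(Aᶜ))).trans_le (h ⟨x, hx⟩)

theorem restr_monotone {X : Type*} {A : Set X} {T : (X → ℝ) → (X → ℝ)} (hT : Monotone T) :
    Monotone (restr A T) := by
  intro f g hfg x
  refine hT (extend_val_le (fun y => ?_) fun y hy => ?_) x
  · rw [Subtype.val_injective.extend_apply]
    exact hfg y
  · rw [Function.extend_apply' _ _ _ (by rintro ⟨z, rfl⟩; exact z.2 hy)]
    rfl

/-- The probability of avoiding `A` for `k` steps is at most that of not being in `A` at step `k`. -/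
theorem restr_iterate_one_le {X : Type*} [Fintype X] [Nonempty X] {A : Set X}
    {T : (X → ℝ) → (X → ℝ)} (hlin : IsLinearMap ℝ T) (hT : Coherent T) (k : ℕ) (x : ↥(Aᶜ)) :
    (restr A T)^[k] 1 x ≤ 1 - T^[k] (A.indicator 1) x := by
  induction k generalizing x with
  | zero => simp [Set.indicator_of_notMem x.2]
  | succ k ih =>
    have hone : T^[k] (A.indicator 1) ≤ 1 := by
      have h := hT.monotone.iterate k
        (Set.indicator_le_self' (s := A) (f := (1 : X → ℝ)) fun _ _ => zero_le_one)
      rwa [Function.iterate_fixed (hT.map_one hlin)] at h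
    have h := hT.monotone (extend_val_le (f := (restr A T)^[k] 1)
      (g := 1 - T^[k] (A.indicator 1)) ih fun y _ => sub_nonneg.2 (hone y)) x
    rw [hlin.map_sub, hT.map_one hlin] at h
    rw [Function.iterate_succ_apply', Function.iterate_succ_apply']
    exact h

theorem stmt13 {X : Type*} [Fintype X] [Nonempty X] (A : Set X)
    (hA : A.Nonempty) (hAc : (Aᶜ : Set X).Nonempty) [Fintype ↥(Aᶜ : Set X)]
    (Tl : (X → ℝ) → (X → ℝ)) (hTl : Coherent Tl) (hR : Reach A Tl)
    (T : (X → ℝ) → (X → ℝ)) (hlin : IsLinearMap ℝ T) (hT : Coherent T)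
    (hdom : ∀ f : X → ℝ, Tl f ≤ T f)
    (M : (↥(Aᶜ) → ℝ) →L[ℝ] (↥(Aᶜ) → ℝ)) (hM : ∀ f, M f = restr A T f) :
    Tendsto (fun k : ℕ => M ^ k) atTop (𝓝 0) ∧
    ∃ N : (↥(Aᶜ) → ℝ) →L[ℝ] (↥(Aᶜ) → ℝ),
      (1 - M) * N = 1 ∧ N * (1 - M) = 1 ∧ HasSum (fun k : ℕ => M ^ k) N := by
  have hMr : ⇑M = restr A T := funext hM
  have hmono : Monotone M := hMr ▸ restr_monotone hT.monotone
  have hind : (0 : X → ℝ) ≤ A.indicator 1 := Set.indicator_nonneg fun _ _ => zero_le_one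
  have hone : M 1 ≤ 1 := fun x => by
    have h1 := restr_iterate_one_le hlin hT 1 x
    have h2 := hT.monotone hind x
    rw [hlin.map_zero, Pi.zero_apply] at h2
    rw [Function.iterate_one, Function.iterate_one] at h1
    rw [hMr, Pi.one_apply]
    linarith
  have hsum : Summable fun k : ℕ => M ^ k := summable_pow_of_monotone hmono hone fun x => by
    obtain ⟨n, -, hn⟩ := hR x x.2
    refine ⟨n, ?_⟩
    have h1 := restr_iterate_one_le hlin hT n x
    have h2 := hTl.monotone.iterate_le_of_le hdom n (A.indicator 1) x
    rw [coe_pow_eq_iterate, hMr]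
    linarith
  exact ⟨hsum.tendsto_atTop_zero, _, hsum.one_sub_mul_tsum_pow, hsum.tsum_pow_mul_one_sub,
    hsum.hasSum⟩
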